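/- Let F_2 = ⟨a, b⟩. If ⟨x⟩ and ⟨y⟩ are vertices of AF_2 with at least 5 common neighbors, then x is a 1-conjugate of y: there exists t such that {x, t} is a basis of F_2 and y is conjugate to x^t (as cyclic subgroups, ⟨y⟩ = ⟨x^t⟩). -/

import Mathlib

open Subgroup

abbrev F2 := FreeGroup (Fin 2)

def IsBasis (x y : F2) : Prop :=
  Function.Bijective (FreeGroup.lift ![x, y] : FreeGroup (Fin 2) →* F2)

def Primitive (x : F2) : Prop := ∃ y : F2, IsBasis x y

/-- The four integer equations, coming from the coefficients of the discriminant. -/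
def Eqs (p q m n : ℤ) : Prop :=
  (m * n) * (p * q) = 0 ∧ (1 - (m + n) * (p + q)) ^ 2 = 1 ∧
  -2 * (1 - (m + n) * (p + q)) * ((m + n) * (p * q) + (m * n) * (p + q))
    + ((m + n) * (q - p) - (m - n)) * ((p + q) * (m - n) - (q - p)) = 0 ∧
  ((m + n) * (p * q) + (m * n) * (p + q)) ^ 2
    + (m * n) * (q - p) * ((p + q) * (m - n) - (q - p))
    + (p * q) * (m - n) * ((m + n) * (q - p) - (m - n)) = 0

theorem Eqs.swap {p q m n : ℤ} (h : Eqs p q m n) : Eqs q p n m := by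
  obtain ⟨h1, h2, h3, h4⟩ := h
  refine ⟨by linarith, by linarith, by linarith, by linarith⟩

theorem mul_two_cases {a b : ℤ} (h : a * b = 2) :
    (a = 1 ∧ b = 2) ∨ (a = 2 ∧ b = 1) ∨ (a = -1 ∧ b = -2) ∨ (a = -2 ∧ b = -1) := by
  have ha : a ∣ 2 := ⟨b, h.symm⟩
  have h1 := Int.le_of_dvd (by norm_num) ha
  have h2 := Int.le_of_dvd (by norm_num) (neg_dvd.mpr ha)
  have h3 : -2 ≤ a := by linarith
  interval_cases a <;> omega

theorem eqs_p0 (q : ℤ) (hq : q ≠ 0) (m n : ℤ) (h : Eqs 0 q m n) :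
    (m = 0 ∧ n = 0) ∨ (m = 1 ∧ n = -1) ∨ (q = -2 ∧ m = 0 ∧ n = -1) ∨ (q = -1 ∧ m = 0 ∧ n = -2)
     ∨ (q = 2 ∧ m = 1 ∧ n = 0) ∨ (q = 1 ∧ m = 2 ∧ n = 0) ∨ (q = 1 ∧ m = 1 ∧ n = 1)
     ∨ (q = -1 ∧ m = -1 ∧ n = -1) := by
  obtain ⟨-, h0, h1, h2⟩ := h
  have e1 : (m + n) * q = 0 ∨ (m + n) * q = 2 := by
    have : ((m + n) * q) * ((m + n) * q - 2) = 0 := by linear_combination h0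
    rcases mul_eq_zero.mp this with h | h
    · exact Or.inl h
    · right; linarith
  have e2 : (m * n) * ((m - 1) * (n + 1)) = 0 := by
    have : q ^ 2 * ((m * n) * ((m - 1) * (n + 1))) = 0 := by linear_combination h2
    exact (mul_eq_zero.mp this).resolve_left (pow_ne_zero _ hq)
  have e3 : -2 * (1 - (m + n) * q) * (m * n) + ((m + n) * q - (m - n)) * (m - n - 1) = 0 := by
    apply (mul_eq_zero.mp (show q * _ = 0 from ?_)).resolve_left hq
    linear_combination h1
  rcases e1 with e | e
  · have hr := (mul_eq_zero.mp e).resolve_right hq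
    obtain rfl : n = -m := by linarith
    have : m * (m - 1) = 0 := by
      simp only [mul_eq_zero] at e2
      have h3 : m * ((m - 1)) * 2 = 0 := by
        rcases e2 with (h | h) | (h | h)
        · simp [h]
        · have : m = 0 := by linarith
          simp [this]
        · simp [h]
        · have : m = 1 := by linarith
          simp [this]
      linarith
    rcases mul_eq_zero.mp this with h | h
    · left; constructor <;> linarith
    · right; left; constructor <;> linarith
  · rcases mul_two_cases e with ⟨hr, rfl⟩ | ⟨hr, rfl⟩ | ⟨hr, rfl⟩ | ⟨hr, rfl⟩
    all_goals
      simp only [mul_eq_zero] at e2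
      rcases e2 with (h | h) | (h | h)
      · obtain rfl := h
        obtain rfl : n = _ := eq_sub_of_add_eq' hr
        omega
      · obtain rfl := h
        obtain rfl : m = _ := eq_sub_of_add_eq hr
        omega
      · obtain rfl : m = 1 := by linarith
        obtain rfl : n = _ := eq_sub_of_add_eq' hr
        omega
      · obtain rfl : n = -1 := by linarith
        obtain rfl : m = _ := eq_sub_of_add_eq hr
        omega

theorem eqs_ne0 (p q : ℤ) (hp : p ≠ 0) (hq : q ≠ 0) (h1 : ¬ (p = 1 ∧ q = -1))
     (n : ℤ) (h : Eqs p q 0 n) : n = 0 ∨ n = 2 / (p + q) := by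
  obtain ⟨-, h0, -, h2⟩ := h
  by_cases hn : n = 0
  · exact Or.inl hn
  right
  have e : n * (p + q) = 0 ∨ n * (p + q) = 2 := by
    have : (n * (p + q)) * (n * (p + q) - 2) = 0 := by linear_combination h0
    rcases mul_eq_zero.mp this with h | h
    · exact Or.inl h
    · right; linarith
  rcases e with e | e
  · exfalso
    have hs := (mul_eq_zero.mp e).resolve_left hn
    obtain rfl : q = -p := by linarith
    have : (n * p)^2 * ((p - 1) * (p - 1)) = 0 := by linear_combination h2
    have := (mul_eq_zero.mp this).resolve_left (pow_ne_zero _ (mul_ne_zero hn hp))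
    have := mul_self_eq_zero.mp this
    exact h1 ⟨by linarith, by linarith⟩
  · have : p + q ≠ 0 := by rintro h; simp [h] at e
    rw [← e, Int.mul_ediv_cancel _ this]

theorem eqs_bound0 (q : ℤ) (hq : q ≠ 0) :
    ∃ L : Finset (ℤ × ℤ), L.card ≤ 4 ∧ ∀ m n, Eqs 0 q m n → (m, n) ∈ L := by
  by_cases h1 : q = 1
  · refine ⟨{(0,0),(1,-1),(2,0),(1,1)}, by decide, fun m n h => ?_⟩
    have := eqs_p0 q hq m n h
    simp only [Finset.mem_insert, Finset.mem_singleton, Prod.mk.injEq]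
    omega
  by_cases h2 : q = -1
  · refine ⟨{(0,0),(1,-1),(0,-2),(-1,-1)}, by decide, fun m n h => ?_⟩
    have := eqs_p0 q hq m n h
    simp only [Finset.mem_insert, Finset.mem_singleton, Prod.mk.injEq]
    omega
  · refine ⟨{(0,0),(1,-1),(0,-1),(1,0)}, by decide, fun m n h => ?_⟩
    have := eqs_p0 q hq m n h
    simp only [Finset.mem_insert, Finset.mem_singleton, Prod.mk.injEq]
    omega

theorem eqs_bound (p q : ℤ) (h00 : ¬ (p = 0 ∧ q = 0)) (h1 : ¬ (p = 1 ∧ q = -1))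
    (h2 : ¬ (p = -1 ∧ q = 1)) :
    ∃ L : Finset (ℤ × ℤ), L.card ≤ 4 ∧ ∀ m n, Eqs p q m n → (m, n) ∈ L := by
  by_cases hp : p = 0
  · subst hp
    exact eqs_bound0 q (by tauto)
  by_cases hq : q = 0
  · subst hq
    obtain ⟨L, hL, h⟩ := eqs_bound0 p hp
    refine ⟨L.image Prod.swap, Finset.card_image_le.trans hL, fun m n hmn => ?_⟩
    exact Finset.mem_image.mpr ⟨(n, m), h n m hmn.swap, rfl⟩
  refine ⟨{(0,0),(0,2/(p+q)),(2/(p+q),0)}, Finset.card_le_three.trans (by norm_num), fun m n h => ?_⟩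
  simp only [Finset.mem_insert, Finset.mem_singleton, Prod.mk.injEq]
  have hmn : m = 0 ∨ n = 0 := by
    have := h.1
    simpa [hp, hq] using this
  rcases hmn with rfl | rfl
  · have := eqs_ne0 p q hp hq h1 n h
    tauto
  · have := eqs_ne0 q p hq hp (by tauto) m h.swap
    rw [add_comm] at this
    tauto
open Polynomial Matrix

/-- The underlying matrix. -/
def umat (g : Matrix.SpecialLinearGroup (Fin 2) ℤ[X]) : Matrix (Fin 2) (Fin 2) ℤ[X] := g
theorem umat_ext {g h : Matrix.SpecialLinearGroup (Fin 2) ℤ[X]} (e : umat g = umat h) : g = h := Subtype.ext e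
theorem umat_mul (g h : Matrix.SpecialLinearGroup (Fin 2) ℤ[X]) : umat (g * h) = umat g * umat h :=
  Matrix.SpecialLinearGroup.coe_mul g h
theorem umat_inv (g : Matrix.SpecialLinearGroup (Fin 2) ℤ[X]) : umat g⁻¹ = (umat g).adjugate :=
  Matrix.SpecialLinearGroup.coe_inv g
theorem umat_one : umat 1 = 1 := Matrix.SpecialLinearGroup.coe_one
theorem umat_det (g : Matrix.SpecialLinearGroup (Fin 2) ℤ[X]) : (umat g).det = 1 :=
  Matrix.SpecialLinearGroup.det_coe g

noncomputable def Am (m : ℤ) : Matrix.SpecialLinearGroup (Fin 2) ℤ[X] :=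
  ⟨!![1, (m : ℤ[X]) * X; 0, 1], by simp [Matrix.det_fin_two]⟩
noncomputable def Bm (m : ℤ) : Matrix.SpecialLinearGroup (Fin 2) ℤ[X] :=
  ⟨!![1, 0; (m : ℤ[X]), 1], by simp [Matrix.det_fin_two]⟩

theorem Am_coe (m : ℤ) : umat (Am m) = !![1, (m : ℤ[X]) * X; 0, 1] := rfl
theorem Bm_coe (m : ℤ) : umat (Bm m) = !![1, 0; (m : ℤ[X]), 1] := rfl

theorem Am_add (m n : ℤ) : Am (m + n) = Am m * Am n := by
  apply umat_ext
  rw [umat_mul, Am_coe, Am_coe, Am_coe, Matrix.mul_fin_two]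
  congr! 3 <;> push_cast <;> ring_nf
theorem Bm_add (m n : ℤ) : Bm (m + n) = Bm m * Bm n := by
  apply umat_ext
  rw [umat_mul, Bm_coe, Bm_coe, Bm_coe, Matrix.mul_fin_two]
  congr! 3 <;> push_cast <;> ring_nf
theorem Am_zero : Am 0 = 1 := by
  apply umat_ext
  rw [Am_coe, umat_one, Matrix.one_fin_two]; simp
theorem Bm_zero : Bm 0 = 1 := by
  apply umat_ext
  rw [Bm_coe, umat_one, Matrix.one_fin_two]; simp

theorem zpow_of_add {G : Type*} [Group G] (f : ℤ → G) (h0 : f 0 = 1)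
    (h : ∀ m n, f (m + n) = f m * f n) (m : ℤ) : f 1 ^ m = f m := by
  induction m using Int.induction_on with
  | zero => simp [h0]
  | succ i ih => rw [_root_.zpow_add, ih, h, zpow_one]
  | pred i ih =>
    rw [_root_.zpow_sub, ih, zpow_one, mul_inv_eq_iff_eq_mul, ← h]; congr 1; ring

noncomputable def rho : F2 →* Matrix.SpecialLinearGroup (Fin 2) ℤ[X] := FreeGroup.lift ![Am 1, Bm 1]

def ga : F2 := FreeGroup.of 0
def gb : F2 := FreeGroup.of 1

theorem rho_a (m : ℤ) : rho (ga ^ m) = Am m := by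
  rw [map_zpow, ← zpow_of_add Am Am_zero Am_add m]; simp [rho, ga]
theorem rho_b (m : ℤ) : rho (gb ^ m) = Bm m := by
  rw [map_zpow, ← zpow_of_add Bm Bm_zero Bm_add m]; simp [rho, gb]

/-- `InSpan U V M`: `M` is a combination of `1, U, V, UV`. -/
def InSpan (U V M : Matrix (Fin 2) (Fin 2) ℤ[X]) : Prop :=
  ∃ c0 c1 c2 c3 : ℤ[X], M = c0 • (1 : Matrix (Fin 2) (Fin 2) ℤ[X]) + c1 • U + c2 • V + c3 • (U * V)

theorem sq_eq {V : Matrix (Fin 2) (Fin 2) ℤ[X]} (hV : V.det = 1) :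
    V * V = (V 0 0 + V 1 1) • V - (1 : Matrix (Fin 2) (Fin 2) ℤ[X]) := by
  rw [Matrix.det_fin_two] at hV
  ext1 i j
  fin_cases i <;> fin_cases j <;> simp [Matrix.mul_apply]
  · linear_combination -hV
  · ring
  · ring
  · linear_combination -hV

theorem inSpan_mulV {U V M : Matrix (Fin 2) (Fin 2) ℤ[X]} (hV : V.det = 1)
    (h : InSpan U V M) : InSpan U V (M * V) := by
  obtain ⟨c0, c1, c2, c3, rfl⟩ := h
  refine ⟨-c2, -c3, c0 + c2 * (V 0 0 + V 1 1), c1 + c3 * (V 0 0 + V 1 1), ?_⟩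
  simp only [add_mul, smul_mul_assoc, one_mul, mul_assoc, sq_eq hV, mul_sub, mul_smul_comm, mul_one]
  module

theorem inSpan_mulU {U V M : Matrix (Fin 2) (Fin 2) ℤ[X]} (hU : U.det = 1)
    (h : InSpan U V M) : InSpan U V (M * U) := by
  obtain ⟨c0, c1, c2, c3, rfl⟩ := h
  have h3 : V * U = - (U * V) + (V 0 0 + V 1 1) • U + (U 0 0 + U 1 1) • V
     + ((U * V) 0 0 + (U * V) 1 1 - (U 0 0 + U 1 1) * (V 0 0 + V 1 1)) •
      (1 : Matrix (Fin 2) (Fin 2) ℤ[X]) := by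
    ext1 i j
    fin_cases i <;> fin_cases j <;> simp [Matrix.mul_apply] <;> ring
  have h4 : U * V * U = V + ((U * V) 0 0 + (U * V) 1 1) • U - (V 0 0 + V 1 1) •
      (1 : Matrix (Fin 2) (Fin 2) ℤ[X]) := by
    rw [Matrix.det_fin_two] at hU
    ext1 i j
    fin_cases i <;> fin_cases j <;> simp [Matrix.mul_apply]
    · linear_combination (-V 1 1) * hU
    · linear_combination (V 0 1) * hU
    · linear_combination (V 1 0) * hU
    · linear_combination (-V 0 0) * hU
  generalize (U * V) 0 0 + (U * V) 1 1 = k at h3 h4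
  refine ⟨-c1 + c2 * (k - (U 0 0 + U 1 1) * (V 0 0 + V 1 1)) - c3 * (V 0 0 + V 1 1),
    c0 + c1 * (U 0 0 + U 1 1) + c2 * (V 0 0 + V 1 1) + c3 * k, c2 * (U 0 0 + U 1 1) + c3, -c2, ?_⟩
  simp only [add_mul, smul_mul_assoc, one_mul, sq_eq hU, h3, h4]
  module

theorem InSpan.lin {U V M N : Matrix (Fin 2) (Fin 2) ℤ[X]} (h : InSpan U V M) (h' : InSpan U V N)
    (c : ℤ[X]) : InSpan U V (c • M - N) := by
  obtain ⟨c0, c1, c2, c3, rfl⟩ := h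
  obtain ⟨d0, d1, d2, d3, rfl⟩ := h'
  exact ⟨c * c0 - d0, c * c1 - d1, c * c2 - d2, c * c3 - d3, by module⟩

theorem mul_inv_coe (U : Matrix.SpecialLinearGroup (Fin 2) ℤ[X]) (M : Matrix (Fin 2) (Fin 2) ℤ[X]) :
    M * umat U⁻¹ = (umat U 0 0 + umat U 1 1) • M - M * umat U := by
  rw [umat_inv, Matrix.adjugate_fin_two]
  ext1 i j
  fin_cases i <;> fin_cases j <;> simp [Matrix.mul_apply] <;> ring

theorem inSpan_all (u v w : F2) : ∀ M, InSpan (umat (rho u)) (umat (rho v)) M →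
    InSpan (umat (rho u)) (umat (rho v)) (M * umat (rho (FreeGroup.lift ![u, v] w))) := by
  induction w using FreeGroup.induction_on with
  | C1 => intro M hM; simpa [umat_one] using hM
  | of i =>
    intro M hM
    fin_cases i
    · simpa using inSpan_mulU (umat_det (rho u)) hM
    · simpa using inSpan_mulV (umat_det (rho v)) hM
  | inv_of i _ =>
    intro M hM
    rw [map_inv, map_inv, mul_inv_coe]
    fin_cases i
    · simpa using hM.lin (inSpan_mulU (umat_det (rho u)) hM) _
    · simpa using hM.lin (inSpan_mulV (umat_det (rho v)) hM) _
  | mul x y hx hy =>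
    intro M hM
    rw [map_mul, map_mul, umat_mul, ← mul_assoc]
    exact hy _ (hx _ hM)

theorem inSpan_of_basis {u v : F2} (h : IsBasis u v) (g : F2) :
    InSpan (umat (rho u)) (umat (rho v)) (umat (rho g)) := by
  obtain ⟨w, rfl⟩ := h.2 g
  have := inSpan_all u v w 1 ⟨1, 0, 0, 0, by simp⟩
  rwa [one_mul] at this

theorem disc_dvd {U V A B : Matrix (Fin 2) (Fin 2) ℤ[X]} (hA : InSpan U V A) (hB : InSpan U V B) :
    (U * V - V * U).det ∣ (A * B - B * A).det := by
  obtain ⟨a0, a1, a2, a3, rfl⟩ := hA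
  obtain ⟨b0, b1, b2, b3, rfl⟩ := hB
  have key : (a0 • (1 : Matrix (Fin 2) (Fin 2) ℤ[X]) + a1 • U + a2 • V + a3 • (U * V)) *
      (b0 • (1 : Matrix (Fin 2) (Fin 2) ℤ[X]) + b1 • U + b2 • V + b3 • (U * V)) -
      (b0 • (1 : Matrix (Fin 2) (Fin 2) ℤ[X]) + b1 • U + b2 • V + b3 • (U * V)) *
      (a0 • (1 : Matrix (Fin 2) (Fin 2) ℤ[X]) + a1 • U + a2 • V + a3 • (U * V)) =
      ((a1 * b2 - a2 * b1) • (1 : Matrix (Fin 2) (Fin 2) ℤ[X]) + (a1 * b3 - a3 * b1) • U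
        - (a2 * b3 - a3 * b2) • V.adjugate) * (U * V - V * U) := by
    rw [Matrix.adjugate_fin_two]
    ext1 i j
    fin_cases i <;> fin_cases j <;> simp [Matrix.mul_apply] <;> ring
  rw [key, det_mul]
  exact dvd_mul_left _ _

theorem disc_dvd_of_basis {u v : F2} (h : IsBasis u v) :
    (umat (rho u) * umat (rho v) - umat (rho v) * umat (rho u)).det ∣ (X : ℤ[X]) ^ 2 := by
  have := disc_dvd (inSpan_of_basis h (ga ^ (1:ℤ))) (inSpan_of_basis h (gb ^ (1:ℤ)))
  rw [rho_a, rho_b, Am_coe, Bm_coe] at this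
  refine this.trans ?_
  simp [Matrix.det_fin_two, sq]

/-- Bases containing `a`: the lower left entry is a unit. -/
theorem unit_of_basis_a {z : F2} (h : IsBasis ga z) : IsUnit (umat (rho z) 1 0) := by
  have := disc_dvd_of_basis h
  have ha : umat (rho ga) = !![1, X; 0, 1] := by
    have := rho_a 1
    rw [zpow_one] at this
    rw [this, Am_coe]; simp
  rw [ha] at this
  generalize umat (rho z) = Z at *
  have e : (!![1, X; 0, 1] * Z - Z * !![1, X; 0, 1]).det = X ^ 2 * (Z 1 0 * -Z 1 0) := by
    rw [Matrix.det_fin_two]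
    simp only [Matrix.sub_apply, Matrix.mul_apply, Fin.sum_univ_two]
    simp; ring
  rw [e] at this
  have h2 : Z 1 0 * -Z 1 0 ∣ 1 := by
    rw [← mul_dvd_mul_iff_left (pow_ne_zero 2 (X_ne_zero (R := ℤ)))]
    simpa using this
  exact isUnit_of_mul_isUnit_left (isUnit_of_dvd_one h2)

inductive Form : ℕ → F2 → Prop
  | base (m n : ℤ) (hn : n ≠ 0) : Form 0 (ga ^ m * gb ^ n)
  | step (k : ℕ) (h : F2) (m n : ℤ) (hm : m ≠ 0) (hn : n ≠ 0) (hh : Form k h) :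
      Form (k + 1) (h * ga ^ m * gb ^ n)

def Nice (g : F2) : Prop := (∃ m : ℤ, g = ga ^ m) ∨ ∃ k h, ∃ m : ℤ, Form k h ∧ g = h * ga ^ m

theorem Nice.mul_a {g : F2} (hg : Nice g) (e : ℤ) : Nice (g * ga ^ e) := by
  rcases hg with ⟨m, rfl⟩ | ⟨k, h, m, hk, rfl⟩
  · exact Or.inl ⟨m + e, by rw [_root_.zpow_add]⟩
  · exact Or.inr ⟨k, h, m + e, hk, by rw [_root_.zpow_add, mul_assoc]⟩

theorem Nice.mul_b {g : F2} (hg : Nice g) (e : ℤ) : Nice (g * gb ^ e) := by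
  by_cases he : e = 0
  · simpa [he] using hg
  rcases hg with ⟨m, rfl⟩ | ⟨k, h, m, hk, rfl⟩
  · exact Or.inr ⟨0, _, 0, Form.base m e he, by simp⟩
  · by_cases hm : m = 0
    · subst hm
      cases hk with
      | base m' n hn =>
        by_cases hne : n + e = 0
        · refine Or.inl ⟨m', ?_⟩
          rw [zpow_zero, mul_one, mul_assoc, ← _root_.zpow_add, hne]; simp
        · refine Or.inr ⟨0, _, 0, Form.base m' (n + e) hne, ?_⟩
          rw [_root_.zpow_add]; simp [mul_assoc]
      | step k' h' m' n hm' hn hh =>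
        by_cases hne : n + e = 0
        · refine Or.inr ⟨k', h', m', hh, ?_⟩
          rw [zpow_zero, mul_one, mul_assoc, ← _root_.zpow_add, hne]; simp
        · refine Or.inr ⟨k' + 1, _, 0, Form.step k' h' m' (n + e) hm' hne hh, ?_⟩
          rw [_root_.zpow_add]; simp [mul_assoc]
    · exact Or.inr ⟨k + 1, _, 0, Form.step k h m e hm he hk, by simp⟩

theorem nice_mul (g : F2) : ∀ h, Nice h → Nice (h * g) := by
  induction g using FreeGroup.induction_on with
  | C1 => intro h hh; simpa using hh
  | of i =>
    intro h hh
    fin_cases i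
    · simpa [ga] using hh.mul_a 1
    · simpa [gb] using hh.mul_b 1
  | inv_of i _ =>
    intro h hh
    fin_cases i
    · simpa [ga] using hh.mul_a (-1)
    · simpa [gb] using hh.mul_b (-1)
  | mul x y hx hy =>
    intro h hh
    rw [← mul_assoc]
    exact hy _ (hx _ hh)

theorem nice_all (g : F2) : Nice g := by
  simpa using nice_mul g 1 (Or.inl ⟨0, by simp⟩)

theorem form_degree {k : ℕ} {g : F2} (h : Form k g) :
    (umat (rho g) 1 0).natDegree ≤ k ∧ (umat (rho g) 1 1).natDegree ≤ k ∧ (umat (rho g) 1 0).coeff k ≠ 0 := by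
  induction h with
  | base m n hn =>
    rw [map_mul, rho_a, rho_b, umat_mul, Am_coe, Bm_coe]
    simp [hn, intCast_coeff_zero]
  | step k h m n hm hn hh ih =>
    obtain ⟨h1, h2, h3⟩ := ih
    rw [map_mul, map_mul, rho_a, rho_b, umat_mul, umat_mul,
      Am_coe, Bm_coe]
    generalize umat (rho h) = H at *
    have e1 : (H * !![1, (m : ℤ[X]) * X; 0, 1] * !![1, 0; (n : ℤ[X]), 1] : Matrix (Fin 2) (Fin 2) ℤ[X]) 1 1
      = C m * (H 1 0 * X) + H 1 1 := by
      simp [Matrix.mul_apply]; ring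
    have e2 : (H * !![1, (m : ℤ[X]) * X; 0, 1] * !![1, 0; (n : ℤ[X]), 1] : Matrix (Fin 2) (Fin 2) ℤ[X]) 1 0
      = H 1 0 + C n * (C m * (H 1 0 * X) + H 1 1) := by
      simp [Matrix.mul_apply]; ring
    have d1 : (C m * (H 1 0 * X) + H 1 1).natDegree ≤ k + 1 := by
      refine natDegree_add_le_of_degree_le ?_ (h2.trans (Nat.le_succ k))
      refine (natDegree_C_mul_le _ _).trans ?_
      exact natDegree_mul_le_of_le h1 natDegree_X_le
    rw [e1, e2]
    refine ⟨?_, d1, ?_⟩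
    · refine natDegree_add_le_of_degree_le (h1.trans (Nat.le_succ k)) ?_
      exact (natDegree_C_mul_le _ _).trans d1
    · rw [coeff_add, coeff_C_mul, coeff_add, coeff_C_mul, coeff_mul_X,
        coeff_eq_zero_of_natDegree_lt (Nat.lt_succ_of_le h1),
        coeff_eq_zero_of_natDegree_lt (Nat.lt_succ_of_le h2)]
      simp [hm, hn, h3]

theorem basis_a {z : F2} (h : IsBasis ga z) :
    ∃ m n : ℤ, zpowers z = zpowers (ga ^ m * gb * ga ^ n) := by
  have hu := unit_of_basis_a h
  rcases nice_all z with ⟨m, rfl⟩ | ⟨k, g, m, hk, rfl⟩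
  · rw [rho_a, Am_coe] at hu
    simp at hu
  · rw [map_mul, rho_a, umat_mul, Am_coe] at hu
    have e : (umat (rho g) * !![1, (m : ℤ[X]) * X; 0, 1] : Matrix (Fin 2) (Fin 2) ℤ[X]) 1 0 = umat (rho g) 1 0 := by
      simp [Matrix.mul_apply]
    rw [e] at hu
    have hd := (form_degree hk).2.2
    cases hk with
    | base m' n hn =>
      rw [map_mul, rho_a, rho_b, umat_mul, Am_coe, Bm_coe] at hu
      have e : (!![1, (m' : ℤ[X]) * X; 0, 1] * !![1, 0; (n : ℤ[X]), 1] : Matrix (Fin 2) (Fin 2) ℤ[X]) 1 0 = C n := by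
        simp [Matrix.mul_apply]
      rw [e, isUnit_C, Int.isUnit_iff] at hu
      rcases hu with rfl | rfl
      · exact ⟨m', m, by simp⟩
      · refine ⟨-m, -m', ?_⟩
        rw [← zpowers_inv]
        simp [mul_assoc]
    | step k h m n hm hn hh =>
      obtain ⟨r, _, hr⟩ := Polynomial.isUnit_iff.mp hu
      rw [← hr, coeff_C_succ] at hd
      exact absurd rfl hd
theorem isBasis_comp (φ : F2 ≃* F2) {u v : F2} : IsBasis (φ u) (φ v) ↔ IsBasis u v := by
  have : (FreeGroup.lift ![φ u, φ v] : FreeGroup (Fin 2) →* F2)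
      = φ.toMonoidHom.comp (FreeGroup.lift ![u, v]) := by
    ext i; fin_cases i <;> simp
  unfold IsBasis
  rw [this, MonoidHom.coe_comp]
  exact φ.bijective.of_comp_iff' _

theorem isBasis_ab : IsBasis ga gb := by
  have : (FreeGroup.lift ![ga, gb] : FreeGroup (Fin 2) →* F2) = MonoidHom.id _ := by
    ext i; fin_cases i <;> simp [ga, gb]
  unfold IsBasis
  rw [this]
  exact Function.bijective_id

/-- precomposition: any substitution invertible on words -/
theorem isBasis_pre {u v u' v' : F2} (ψ : F2 ≃* F2)
    (h0 : FreeGroup.lift ![u, v] (ψ ga) = u') (h1 : FreeGroup.lift ![u, v] (ψ gb) = v')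
    (h : IsBasis u v) : IsBasis u' v' := by
  have : (FreeGroup.lift ![u', v'] : FreeGroup (Fin 2) →* F2)
      = (FreeGroup.lift ![u, v]).comp ψ.toMonoidHom := by
    ext i; fin_cases i
    · simpa [ga] using h0.symm
    · simpa [gb] using h1.symm
  unfold IsBasis
  rw [this, MonoidHom.coe_comp]
  exact h.comp ψ.bijective

/-- An involution on words. -/
def invol (u v : F2) (h : (FreeGroup.lift ![u, v] : F2 →* F2).comp (FreeGroup.lift ![u, v])
    = MonoidHom.id F2) : F2 ≃* F2 :=
  MonoidHom.toMulEquiv (FreeGroup.lift ![u, v]) (FreeGroup.lift ![u, v]) h h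

def swapAB : F2 ≃* F2 := invol gb ga (by ext i; fin_cases i <;> simp [ga, gb])
def invA : F2 ≃* F2 := invol ga⁻¹ gb (by ext i; fin_cases i <;> simp [ga, gb])
theorem swapAB_a : swapAB ga = gb := by simp [swapAB, invol, ga]
theorem swapAB_b : swapAB gb = ga := by simp [swapAB, invol, gb]
theorem invA_a : invA ga = ga⁻¹ := by simp [invA, invol, ga]
theorem invA_b : invA gb = gb := by simp [invA, invol, gb]

theorem IsBasis.swap {u v : F2} (h : IsBasis u v) : IsBasis v u := by
  refine isBasis_pre swapAB ?_ ?_ h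
  · rw [swapAB_a]; simp [gb]
  · rw [swapAB_b]; simp [ga]
theorem IsBasis.inv_left {u v : F2} (h : IsBasis u v) : IsBasis u⁻¹ v := by
  refine isBasis_pre invA ?_ ?_ h
  · rw [invA_a]; simp [ga]
  · rw [invA_b]; simp [gb]
theorem IsBasis.inv_right {u v : F2} (h : IsBasis u v) : IsBasis u v⁻¹ := h.swap.inv_left.swap

/-- `F₂` is torsion free, so generators of a cyclic subgroup are unique up to inversion. -/
theorem eq_or_inv {x y : F2} (h : zpowers x = zpowers y) : y = x ∨ y = x⁻¹ := by
  obtain ⟨i, hi⟩ := mem_zpowers_iff.mp (h ▸ mem_zpowers x : x ∈ zpowers y)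
  obtain ⟨j, hj⟩ := mem_zpowers_iff.mp (h ▸ mem_zpowers y : y ∈ zpowers x)
  by_cases hx : x = 1
  · subst hx; left; simpa using hj.symm
  have : x ^ (j * i - 1) = 1 := by
    rw [_root_.zpow_sub, _root_.zpow_mul, hj, hi]; simp
  have hinf : j * i - 1 = 0 := by
    by_contra hne
    exact hx ((IsMulTorsionFree.zpow_eq_one_iff_left hne).mp this)
  have : IsUnit j := IsUnit.of_mul_eq_one i (by linarith)
  rcases Int.isUnit_iff.mp this with rfl | rfl
  · left; simpa using hj.symm
  · right; simpa using hj.symm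

theorem IsBasis.congr {u v u' v' : F2} (h : IsBasis u v) (hu : zpowers u = zpowers u')
    (hv : zpowers v = zpowers v') : IsBasis u' v' := by
  rcases eq_or_inv hu with rfl | rfl <;> rcases eq_or_inv hv with rfl | rfl
  · exact h
  · exact h.inv_right
  · exact h.inv_left
  · exact h.inv_left.inv_right

theorem basis_b {y : F2} (h : IsBasis y gb) :
    ∃ p q : ℤ, zpowers y = zpowers (gb ^ p * ga * gb ^ q) := by
  have h' : IsBasis ga (swapAB y) := by
    rw [← swapAB_b, isBasis_comp]; exact h.swap
  obtain ⟨p, q, e⟩ := basis_a h'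
  refine ⟨p, q, ?_⟩
  have hs : ∀ w, swapAB (swapAB w) = w := fun w => swapAB.symm_apply_apply w
  have := congrArg (Subgroup.map swapAB.toMonoidHom) e
  rw [MonoidHom.map_zpowers, MonoidHom.map_zpowers] at this
  simpa [hs, swapAB_a, swapAB_b] using this

theorem eqs_of_basis {p q m n : ℤ}
    (h : IsBasis (gb ^ p * ga * gb ^ q) (ga ^ m * gb * ga ^ n)) : Eqs p q m n := by
  have hd := disc_dvd_of_basis h
  have hU : umat (rho (gb ^ p * ga * gb ^ q)) = !![1 + C q * X, X; C (p + q) + C (p * q) * X, 1 + C p * X] := by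
    have := rho_a 1
    rw [zpow_one] at this
    rw [map_mul, map_mul, this, rho_b, rho_b, umat_mul, umat_mul, Am_coe, Bm_coe, Bm_coe,
      Matrix.mul_fin_two, Matrix.mul_fin_two]
    simp; ring_nf; simp
  have hV : umat (rho (ga ^ m * gb * ga ^ n)) = !![1 + C m * X, C (m + n) * X + C (m * n) * X ^ 2; 1, 1 + C n * X] := by
    have := rho_b 1
    rw [zpow_one] at this
    rw [map_mul, map_mul, this, rho_a, rho_a, umat_mul, umat_mul, Am_coe, Bm_coe, Am_coe,
      Matrix.mul_fin_two, Matrix.mul_fin_two]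
    simp; ring_nf; simp
  rw [hU, hV] at hd
  obtain ⟨r, hr⟩ : ∃ r : ℤ, r = m + n := ⟨_, rfl⟩
  obtain ⟨s, hs⟩ : ∃ s : ℤ, s = p + q := ⟨_, rfl⟩
  obtain ⟨μ, hμ⟩ : ∃ μ : ℤ, μ = m * n := ⟨_, rfl⟩
  obtain ⟨σ, hσ⟩ : ∃ σ : ℤ, σ = p * q := ⟨_, rfl⟩
  have e : (!![1 + C q * X, X; C (p + q) + C (p * q) * X, 1 + C p * X] *
      !![1 + C m * X, C (m + n) * X + C (m * n) * X ^ 2; 1, 1 + C n * X] -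
      !![1 + C m * X, C (m + n) * X + C (m * n) * X ^ 2; 1, 1 + C n * X] *
      !![1 + C q * X, X; C (p + q) + C (p * q) * X, 1 + C p * X]).det =
      X ^ 2 * -(C ((1 - r * s) ^ 2) +
        C (-2 * (1 - r * s) * (r * σ + μ * s)
          + (r * (q - p) - (m - n)) * (s * (m - n) - (q - p))) * X +
        C ((r * σ + μ * s) ^ 2 - 2 * (1 - r * s) * (μ * σ) + μ * (q - p) * (s * (m - n) - (q - p))
          + σ * (m - n) * (r * (q - p) - (m - n))) * X ^ 2 +
        C (2 * (r * σ + μ * s) * (μ * σ) + μ * σ * (q - p) * (m - n)) * X ^ 3 +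
        C ((μ * σ) ^ 2) * X ^ 4) := by
    rw [← hr, ← hs, ← hμ, ← hσ, Matrix.det_fin_two]
    simp only [Matrix.sub_apply, Matrix.mul_apply, Fin.sum_univ_two]
    simp only [map_add, map_sub, map_mul, map_pow, map_neg, map_one, map_ofNat]
    simp; ring
  rw [e] at hd
  have h2 := (mul_dvd_mul_iff_left (pow_ne_zero 2 (X_ne_zero (R := ℤ)))).mp
    (hd.trans (mul_one ((X : ℤ[X]) ^ 2)).symm.dvd)
  have h3 := (isUnit_of_dvd_one h2).neg
  rw [neg_neg] at h3
  obtain ⟨w, hw, hQ⟩ := Polynomial.isUnit_iff.mp h3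
  have c0 := congrArg (fun P => coeff P 0) hQ
  have c1 := congrArg (fun P => coeff P 1) hQ
  have c2 := congrArg (fun P => coeff P 2) hQ
  have c4 := congrArg (fun P => coeff P 4) hQ
  simp only [coeff_add, coeff_C_mul, coeff_C, coeff_X_pow, coeff_X] at c0 c1 c2 c4
  norm_num at c0 c1 c2 c4
  have hμσ : μ * σ = 0 := by
    exact pow_eq_zero_iff (two_ne_zero) |>.mp c4.symm
  unfold Eqs
  rw [← hr, ← hs, ← hμ, ← hσ]
  refine ⟨hμσ, ?_, ?_, ?_⟩
  · rcases Int.isUnit_iff.mp hw with rfl | rfl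
    · exact c0.symm
    · have := sq_nonneg (1 - r * s); omega
  · linear_combination -c1
  · linear_combination -c2 + 2 * (1 - r * s) * hμσ

/-- The bound in normal position. -/
theorem core {y : F2} (hy : IsBasis y gb) (hne : zpowers ga ≠ zpowers y)
    (hno : ¬ ∃ t : F2, IsBasis ga t ∧ zpowers y = zpowers (t⁻¹ * ga * t)) :
    ∃ L : Finset (Subgroup F2), L.card ≤ 4 ∧
      ∀ z, IsBasis ga z → IsBasis y z → zpowers z ∈ L := by
  classical
  obtain ⟨p, q, hpq⟩ := basis_b hy
  obtain ⟨L, hL, hmem⟩ := eqs_bound p q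
    (by rintro ⟨rfl, rfl⟩; exact hne (by simpa using hpq.symm))
    (by rintro ⟨rfl, rfl⟩
        exact hno ⟨gb⁻¹, isBasis_ab.inv_right, by simpa using hpq⟩)
    (by rintro ⟨rfl, rfl⟩
        exact hno ⟨gb, isBasis_ab, by simpa using hpq⟩)
  refine ⟨L.image fun mn => zpowers (ga ^ mn.1 * gb * ga ^ mn.2),
    Finset.card_image_le.trans hL, fun z hz hyz => ?_⟩
  obtain ⟨m, n, hmn⟩ := basis_a hz
  exact Finset.mem_image.mpr ⟨(m, n), hmem m n (eqs_of_basis (hyz.congr hpq hmn)), hmn.symm⟩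

/-- If two distinct vertices `⟨x⟩`, `⟨y⟩` of `AF₂` have at least 5 common neighbors,
then `x` is a 1-conjugate of `y`: there is `t` with `{x, t}` a basis and
`⟨y⟩ = ⟨x^t⟩`. -/
theorem five_common_neighbors_implies_one_conjugate (x y : F2)
    (hx : Primitive x) (hy : Primitive y) (hne : zpowers x ≠ zpowers y)
    (h5 : ∃ s : Finset (Subgroup F2), 5 ≤ s.card ∧
      ∀ S ∈ s, ∃ z : F2, S = zpowers z ∧ IsBasis x z ∧ IsBasis y z) :
    ∃ t : F2, IsBasis x t ∧ zpowers y = zpowers (t⁻¹ * x * t) := by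
  classical
  by_contra hno
  obtain ⟨s, hs5, hs⟩ := h5
  obtain ⟨S, hS⟩ := Finset.card_pos.mp (by omega : 0 < s.card)
  obtain ⟨z, -, hxz, hyz⟩ := hs S hS
  let φ : F2 ≃* F2 := MulEquiv.ofBijective (FreeGroup.lift ![x, z]) hxz
  have hφa : φ ga = x := (FreeGroup.lift_apply_of).trans rfl
  have hφb : φ gb = z := (FreeGroup.lift_apply_of).trans rfl
  have hmap : ∀ w : F2, Subgroup.map φ.toMonoidHom (zpowers w) = zpowers (φ w) := fun w =>
    MonoidHom.map_zpowers _ _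
  obtain ⟨y', rfl⟩ := φ.surjective y
  clear_value φ
  subst hφa hφb
  obtain ⟨L, hL, hmem⟩ := core ((isBasis_comp φ).mp hyz)
    (fun e => hne (by rw [← hmap, ← hmap, e]))
    (by
      rintro ⟨t, ht, e⟩
      refine hno ⟨φ t, (isBasis_comp φ).mpr ht, ?_⟩
      rw [← hmap, e, hmap]; simp)
  have hsub : s ⊆ L.image (Subgroup.map φ.toMonoidHom) := by
    intro T hT
    obtain ⟨w, rfl, hw1, hw2⟩ := hs T hT
    obtain ⟨w', rfl⟩ := φ.surjective w
    exact Finset.mem_image.mpr ⟨_, hmem w' ((isBasis_comp φ).mp hw1) ((isBasis_comp φ).mp hw2),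
      hmap w'⟩
  have := (Finset.card_le_card hsub).trans Finset.card_image_le
  omega
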